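/- For every multi-index ν and every unit multi-index e (i.e. |e| = 1), the double sum over multi-indices η with 0 < η ≤ ν and multi-indices ℓ with 0 < ℓ ≤ η of (ν choose η) · (η choose ℓ) · [1/2]_{|η−ℓ|} · [1/2]_{|ℓ|} · [1/2]_{|ν+e−η|} is at most 3 · [1/2]_{|ν+e|}. -/

import Mathlib

/-- The absolute falling factorial `[1/2]_n`: `[1/2]_0 = 1`, and
`[1/2]_{n+1} = |n - 1/2| * [1/2]_n`, so that `[1/2]_1 = 1/2`. -/
noncomputable def gd : ℕ → ℝ
  | 0 => 1
  | n + 1 => |(n : ℝ) - 1 / 2| * gd n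

/-- The total degree `|ν| = Σ_j ν_j` of a multi-index. -/
def deg (ν : ℕ →₀ ℕ) : ℕ := ν.sum fun _ n => n

/-- The multi-index binomial coefficient `(ν choose η) = Π_j (ν_j choose η_j)`. -/
def mchoose (ν η : ℕ →₀ ℕ) : ℕ := ∏ j ∈ ν.support ∪ η.support, (ν j).choose (η j)

open Finset in
theorem gd_nonneg' (n : ℕ) : 0 ≤ gd n := by
  induction n with
  | zero => simp [gd]
  | succ n ih => rw [gd]; positivity

theorem gd_succ' (n : ℕ) (hn : 1 ≤ n) : gd (n + 1) = ((n : ℝ) - 1 / 2) * gd n := by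
  rw [gd, abs_of_nonneg]
  have : (1 : ℝ) ≤ n := by exact_mod_cast hn
  linarith

theorem gd_one' : gd 1 = 1 / 2 := by
  norm_num [gd]

noncomputable def gps : PowerSeries ℝ := PowerSeries.mk fun n => gd n / n.factorial

open PowerSeries in
theorem gps_ode : (1 - X) * (2 * derivative ℝ gps) = 2 - gps := by
  ext n
  have h2 : (2 : PowerSeries ℝ) = C 2 := (map_ofNat _ 2).symm
  rw [h2, sub_mul, one_mul, map_sub, map_sub]
  rcases n with _ | n
  · simp [coeff_derivative, gps, gd]
    norm_num
  · rw [coeff_succ_X_mul]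
    simp only [coeff_C_mul, coeff_derivative, coeff_C, gps, coeff_mk]
    rw [gd_succ' (n + 1) (by omega)]
    have := Nat.factorial_pos n
    have : (n.factorial : ℝ) ≠ 0 := by positivity
    simp only [Nat.factorial_succ]
    push_cast
    simp
    field_simp
    ring

open PowerSeries in
theorem gps_sq_coeff (n : ℕ) (hn : 2 ≤ n) : coeff n ((gps - 2) * (gps - 2)) = 0 := by
  have hd : (1 - X) * derivative ℝ ((gps - 2) * (gps - 2)) = - ((gps - 2) * (gps - 2)) := by
    have h2 : (2 : PowerSeries ℝ) = C 2 := (map_ofNat _ 2).symm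
    have h0 : derivative ℝ (gps - 2) = derivative ℝ gps := by
      rw [map_sub, h2]; simp
    rw [Derivation.leibniz, h0, smul_eq_mul]
    linear_combination (gps - 2) * gps_ode
  generalize (gps - 2) * (gps - 2) = H at hd
  induction n, hn using Nat.le_induction with
  | base =>
    have := congrArg (coeff 1) hd
    rw [sub_mul, one_mul, map_sub, ← zero_add 1, coeff_succ_X_mul] at this
    simp [coeff_derivative] at this
    simpa using this
  | succ n hn ih =>
    have := congrArg (coeff n) hd
    obtain ⟨m, rfl⟩ : ∃ m, n = m + 1 := ⟨n - 1, by omega⟩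
    rw [sub_mul, one_mul, map_sub, coeff_succ_X_mul] at this
    simp only [coeff_derivative, map_neg, ih] at this
    have h3 : ((m + 1 : ℕ) : ℝ) + 1 ≠ 0 := by positivity
    simp only [zero_mul, sub_zero, neg_zero] at this
    exact (mul_eq_zero.mp this).resolve_right h3

open Finset in
theorem gd_conv (n : ℕ) (hn : 2 ≤ n) :
    ∑ k ∈ range (n + 1), (n.choose k : ℝ) * (gd k * gd (n - k)) = 4 * gd n := by
  have h := gps_sq_coeff n hn
  have h2 : (2 : PowerSeries ℝ) = PowerSeries.C 2 := (map_ofNat _ 2).symm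
  have e : (gps - 2) * (gps - 2)
      = gps * gps - PowerSeries.C 4 * gps + PowerSeries.C 4 := by
    have h4 : (4 : PowerSeries ℝ) = PowerSeries.C 4 := (map_ofNat _ 4).symm
    rw [← h4]; ring
  rw [e, map_add, map_sub, PowerSeries.coeff_C_mul, PowerSeries.coeff_C, if_neg (by omega),
    PowerSeries.coeff_mul, Finset.Nat.sum_antidiagonal_eq_sum_range_succ_mk] at h
  simp only [gps, PowerSeries.coeff_mk] at h
  have hf : (n.factorial : ℝ) ≠ 0 := by positivity
  have h5 : ∑ k ∈ range (n + 1), (n.choose k : ℝ) * (gd k * gd (n - k))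
    = n.factorial * ∑ k ∈ range n.succ,
      gd k / k.factorial * (gd (n - k) / (n - k).factorial) := by
    rw [mul_sum]
    refine sum_congr rfl fun k hk => ?_
    rw [Nat.cast_choose ℝ (by simp at hk; omega)]
    field_simp
  rw [h5]
  have h6 : ∑ k ∈ range n.succ, gd k / k.factorial * (gd (n - k) / (n - k).factorial)
    = 4 * (gd n / n.factorial) := by linarith
  rw [h6]; field_simp

open Finset in
theorem gd_T (k : ℕ) (hk : 1 ≤ k) :
    ∑ l ∈ range (k + 1), (k.choose l : ℝ) * (gd l * gd (k - l)) - gd k ≤ 3 * gd k := by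
  rcases hk.lt_or_eq with h | h
  · rw [gd_conv k h]; linarith
  · subst h
    norm_num [sum_range_succ, gd]

open Finset in
theorem gd_conv' (n : ℕ) (hn : 1 ≤ n) :
    ∑ k ∈ range (n + 1), (n.choose k : ℝ) * (gd k * gd (n + 1 - k)) = 2 * gd (n + 1) := by
  have h := gd_conv (n + 1) (by omega)
  have h1 : ∑ k ∈ range (n + 2), ((n + 1).choose k : ℝ) * (gd k * gd (n + 1 - k))
    = ∑ k ∈ range (n + 1), (n.choose k : ℝ) * (gd k * gd (n + 1 - k))
     + ∑ k ∈ range (n + 1), (n.choose k : ℝ) * (gd (k + 1) * gd (n - k)) := by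
    rw [sum_range_succ']
    simp only [Nat.choose_succ_succ, Nat.cast_add, add_mul, sum_add_distrib]
    have : ∑ k ∈ range (n + 1), (n.choose k : ℝ) * (gd k * gd (n + 1 - k))
      = ∑ k ∈ range (n + 1), (n.choose (k + 1) : ℝ) * (gd (k + 1) * gd (n + 1 - (k + 1)))
       + gd 0 * gd (n + 1) := by
      rw [sum_range_succ', sum_range_succ _ n]
      simp
    rw [this]
    simp only [Nat.add_sub_add_right]
    simp
    ring
  have h2 : ∑ k ∈ range (n + 1), (n.choose k : ℝ) * (gd (k + 1) * gd (n - k))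
    = ∑ k ∈ range (n + 1), (n.choose k : ℝ) * (gd k * gd (n + 1 - k)) := by
    rw [← sum_range_reflect]
    refine sum_congr rfl fun k hk => ?_
    have hk' : k ≤ n := by simp at hk; omega
    have e1 : n + 1 - 1 - k = n - k := by omega
    have e2 : n - k + 1 = n + 1 - k := by omega
    have e3 : n - (n - k) = k := by omega
    rw [e1, e2, e3, Nat.choose_symm hk']
    ring
  linarith

theorem deg_eq_sum (ν : ℕ →₀ ℕ) (s : Finset ℕ) (h : ν.support ⊆ s) : deg ν = ∑ j ∈ s, ν j :=
  Finsupp.sum_of_support_subset _ h _ (by simp)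

theorem deg_add' (a b : ℕ →₀ ℕ) : deg (a + b) = deg a + deg b :=
  Finsupp.sum_add_index' (by simp) (by simp)

theorem deg_sub' (a b : ℕ →₀ ℕ) (h : b ≤ a) : deg (a - b) = deg a - deg b := by
  have := deg_add' (a - b) b
  rw [tsub_add_cancel_of_le h] at this
  omega

theorem deg_le' (a b : ℕ →₀ ℕ) (h : b ≤ a) : deg b ≤ deg a := by
  have := deg_add' (a - b) b
  rw [tsub_add_cancel_of_le h] at this
  omega

open Finset Polynomial in
theorem mchoose_poly (ν : ℕ →₀ ℕ) :
    ∑ η ∈ Icc 0 ν, (C (mchoose ν η : ℝ) * X ^ deg η : ℝ[X]) = (X + 1) ^ deg ν := by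
  have h : ∏ j ∈ ν.support, ∑ k ∈ Icc 0 (ν j), (C ((ν j).choose k : ℝ) * X ^ k : ℝ[X])
      = (X + 1) ^ deg ν := by
    rw [deg, Finsupp.sum, ← prod_pow_eq_pow_sum]
    refine prod_congr rfl fun j _ => ?_
    rw [add_pow, ← Nat.range_succ_eq_Icc_zero]
    refine sum_congr rfl fun k _ => ?_
    simp [mul_comm]
  have hI : Icc 0 ν = ν.support.finsupp (fun j => Icc 0 (ν j)) := by
    ext η
    rw [mem_Icc, mem_finsupp_iff]
    constructor
    · rintro ⟨-, h2⟩
      exact ⟨Finsupp.support_mono h2, fun j _ => mem_Icc.mpr ⟨Nat.zero_le _, h2 j⟩⟩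
    · rintro ⟨h1, h2⟩
      refine ⟨zero_le, fun j => ?_⟩
      by_cases hj : j ∈ ν.support
      · exact (mem_Icc.mp (h2 j hj)).2
      · have : η j = 0 := by
          by_contra hc
          exact hj (h1 (Finsupp.mem_support_iff.mpr hc))
        omega
  rw [← h, prod_sum, hI, Finset.finsupp, sum_map]
  refine sum_congr (by congr!) fun p hp => ?_
  simp only [Function.Embedding.coeFn_mk]
  have hs : (Finsupp.indicator ν.support p).support ⊆ ν.support :=
    Finsupp.support_indicator_subset _ _
  rw [deg_eq_sum _ _ hs, mchoose, union_eq_left.mpr hs, prod_mul_distrib, Nat.cast_prod, map_prod,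
    ← prod_pow_eq_pow_sum]
  congr 1
  · rw [← prod_attach]
    refine prod_congr rfl fun j _ => ?_
    simp
  · rw [← prod_attach]
    refine prod_congr rfl fun j _ => ?_
    simp

open Finset Polynomial in
theorem mchoose_sum (ν : ℕ →₀ ℕ) (f : ℕ → ℝ) :
    ∑ η ∈ Icc 0 ν, (mchoose ν η : ℝ) * f (deg η)
      = ∑ k ∈ range (deg ν + 1), ((deg ν).choose k : ℝ) * f k := by
  have h : ∀ k, ((deg ν).choose k : ℝ)
      = ∑ η ∈ Icc 0 ν, if k = deg η then (mchoose ν η : ℝ) else 0 := by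
    intro k
    have := congrArg (fun p => Polynomial.coeff p k) (mchoose_poly ν)
    simp only [finsetSum_coeff, coeff_C_mul_X_pow, coeff_X_add_one_pow] at this
    exact this.symm
  simp only [h, sum_mul]
  rw [sum_comm]
  refine sum_congr rfl fun η hη => ?_
  have := deg_le' ν η (mem_Icc.mp hη).2
  simp only [ite_mul, zero_mul]
  rw [sum_ite_eq' , if_pos (by simp; omega)]

theorem mchoose_zero' (ν : ℕ →₀ ℕ) : mchoose ν 0 = 1 := by simp [mchoose]

theorem deg_zero' : deg 0 = 0 := by simp [deg]

open Finset in
theorem mchoose_sum_Ioc (ν : ℕ →₀ ℕ) (f : ℕ → ℝ) :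
    ∑ η ∈ Ioc 0 ν, (mchoose ν η : ℝ) * f (deg η)
      = ∑ k ∈ range (deg ν + 1), ((deg ν).choose k : ℝ) * f k - f 0 := by
  rw [← mchoose_sum, ← Finset.Icc_erase_left, ← Finset.add_sum_erase (Icc 0 ν) _ (a := 0) (by simp)]
  simp [mchoose_zero', deg_zero']

theorem stmt7 (ν e : ℕ →₀ ℕ) (he : deg e = 1) :
    ∑ η ∈ Finset.Ioc 0 ν, ∑ l ∈ Finset.Ioc 0 η,
        (mchoose ν η : ℝ) * (mchoose η l : ℝ) * gd (deg (η - l)) * gd (deg l) *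
          gd (deg (ν + e - η))
      ≤ 3 * gd (deg (ν + e)) := by
  have hpos : ∀ η ∈ Finset.Ioc 0 ν, 1 ≤ deg η := by
    intro η hη
    by_contra hc
    have h0 : deg η = 0 := by omega
    have : η = 0 := by
      rw [deg, Finsupp.sum, Finset.sum_eq_zero_iff] at h0
      ext j
      by_cases hj : j ∈ η.support
      · exact h0 j hj
      · simpa using hj
    exact (Finset.mem_Ioc.mp hη).1.ne this.symm
  have key : ∀ η ∈ Finset.Ioc 0 ν, ∑ l ∈ Finset.Ioc 0 η,
        (mchoose ν η : ℝ) * (mchoose η l : ℝ) * gd (deg (η - l)) * gd (deg l) *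
          gd (deg (ν + e - η))
      ≤ (mchoose ν η : ℝ) * (fun k => 3 * (gd k * gd (deg ν + 1 - k))) (deg η) := by
    intro η hη
    have hle := (Finset.mem_Ioc.mp hη).2
    have hd : deg (ν + e - η) = deg ν + 1 - deg η := by
      rw [deg_sub' _ _ (hle.trans (by simp)), deg_add', he]
    have h1 : ∑ l ∈ Finset.Ioc 0 η,
        (mchoose ν η : ℝ) * (mchoose η l : ℝ) * gd (deg (η - l)) * gd (deg l) *
          gd (deg (ν + e - η)) = (mchoose ν η : ℝ) * gd (deg ν + 1 - deg η) *
          ∑ l ∈ Finset.Ioc 0 η, (mchoose η l : ℝ) *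
            (fun k => gd k * gd (deg η - k)) (deg l) := by
      rw [Finset.mul_sum]
      refine Finset.sum_congr rfl fun l hl => ?_
      rw [hd, deg_sub' _ _ (Finset.mem_Ioc.mp hl).2]
      ring
    rw [h1, mchoose_sum_Ioc η (fun k => gd k * gd (deg η - k))]
    have h2 := gd_T (deg η) (hpos η hη)
    have h3 := gd_nonneg' (deg ν + 1 - deg η)
    have h4 : (0 : ℝ) ≤ mchoose ν η * gd (deg ν + 1 - deg η) := by positivity
    have h5 := mul_le_mul_of_nonneg_left h2 h4
    simp only [gd, Nat.sub_zero, one_mul]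
    linarith
  refine (Finset.sum_le_sum key).trans ?_
  rw [mchoose_sum_Ioc ν (fun k => 3 * (gd k * gd (deg ν + 1 - k))), deg_add', he]
  rcases Nat.eq_zero_or_pos (deg ν) with h0 | h0
  · rw [h0]
    norm_num [gd]
  · have := gd_conv' (deg ν) h0
    have e1 : ∀ k, ((deg ν).choose k : ℝ) * (3 * (gd k * gd (deg ν + 1 - k)))
      = 3 * (((deg ν).choose k : ℝ) * (gd k * gd (deg ν + 1 - k))) := fun k => by ring
    simp only [e1, ← Finset.mul_sum]
    rw [this]
    have : gd 0 = 1 := rfl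
    simp only [this, Nat.sub_zero]
    linarith
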